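/- Fix y = (y₁,y₂,y₃) ∈ ℝ³ with y₃ > 0 and vectors g, ν ∈ ℝ³. Define u^{D,W}ᵢ(x) = Σⱼ Σₖ Tᴰᵢⱼₖ(x,y) νₖ gⱼ − Σⱼ Σₖ Tᴰᵢⱼₖ(x,yᴵ) νᴵₖ gᴵⱼ − [x₃ ∂φᴰ/∂xᵢ(x) − δᵢ₃ φᴰ(x)], where φᴰ(x) = −2 νᴵ₃ Gᴰ[gᴵ](x,yᴵ) + 2 gᴵ₃ Gᴰ[νᴵ](x,yᴵ) + 2 y₃ G^Q[νᴵ, gᴵ](x,yᴵ). Then u^{D,W} satisfies the no-slip condition: u^{D,W}ᵢ(x) = 0 for all i = 1,2,3 and every x = (x₁,x₂,0) with x ≠ yᴵ. -/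

import Mathlib

open Real Finset

noncomputable section

/-- Points in three-dimensional Euclidean space. -/
abbrev E3 := EuclideanSpace ℝ (Fin 3)

/-- Partial derivative `∂f/∂xᵢ` of a scalar field on `ℝ³`. -/
def pd (i : Fin 3) (f : E3 → ℝ) (x : E3) : ℝ :=
  fderiv ℝ f x (EuclideanSpace.single i 1)

/-- Kronecker delta. -/
def kron (i j : Fin 3) : ℝ := if i = j then 1 else 0

/-- Reflected image point `yᴵ = (y₁, y₂, -y₃)`. -/
def reflPt (y : E3) : E3 := (EuclideanSpace.equiv (Fin 3) ℝ).symm ![y 0, y 1, -y 2]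

/-- Reflected vector `fᴵ = (f₁, f₂, -f₃)`. -/
def reflVec (f : Fin 3 → ℝ) : Fin 3 → ℝ := ![f 0, f 1, -f 2]

/-- Harmonic potential of a unit charge, `Gˢ(x,y) = 1/(4π|x-y|)`. -/
def GS (x y : E3) : ℝ := 1 / (4 * π * ‖x - y‖)

/-- Harmonic potential of a unit dipole with orientation `ν`:
`Gᴰ[ν](x,y) = Σᵢ νᵢ ∂/∂yᵢ Gˢ(x,y)`. -/
def GD (ν : Fin 3 → ℝ) (x y : E3) : ℝ := ∑ i, ν i * pd i (fun z => GS x z) y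

/-- Harmonic potential of a unit quadrupole with orientations `ν, κ`:
`G^Q[ν,κ](x,y) = Σᵢ Σⱼ νᵢ κⱼ ∂²/∂yᵢ∂yⱼ Gˢ(x,y)`. -/
def GQ (ν κ : Fin 3 → ℝ) (x y : E3) : ℝ :=
  ∑ i, ∑ j, ν i * κ j * pd i (fun z => pd j (fun w => GS x w) z) y

/-- The Stokes doublet
`Tᴰᵢⱼₖ(x,y) = (1/4π)[-(xᵢ-yᵢ)δⱼₖ/|x-y|³ - (xⱼ-yⱼ)δᵢₖ/|x-y|³ + (xₖ-yₖ)δᵢⱼ/|x-y|³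
  + 3(xᵢ-yᵢ)(xⱼ-yⱼ)(xₖ-yₖ)/|x-y|⁵]`. -/
def TD (x y : E3) (i j k : Fin 3) : ℝ :=
  (1 / (4 * π)) * (-(x i - y i) * kron j k / ‖x - y‖ ^ 3
    - (x j - y j) * kron i k / ‖x - y‖ ^ 3
    + (x k - y k) * kron i j / ‖x - y‖ ^ 3
    + 3 * (x i - y i) * (x j - y j) * (x k - y k) / ‖x - y‖ ^ 5)

/-- The Papkovich–Neuber potential for the Stokes doublet image system:
`φᴰ(x) = -2 νᴵ₃ Gᴰ[gᴵ](x,yᴵ) + 2 gᴵ₃ Gᴰ[νᴵ](x,yᴵ) + 2 y₃ G^Q[νᴵ,gᴵ](x,yᴵ)`. -/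
def phiD (y : E3) (g ν : Fin 3 → ℝ) (x : E3) : ℝ :=
  -2 * reflVec ν 2 * GD (reflVec g) x (reflPt y)
    + 2 * reflVec g 2 * GD (reflVec ν) x (reflPt y)
    + 2 * y 2 * GQ (reflVec ν) (reflVec g) x (reflPt y)

/-- The half-space Stokes doublet velocity `u^{D,W}`. -/
def uDW (y : E3) (g ν : Fin 3 → ℝ) (i : Fin 3) (x : E3) : ℝ :=
  (∑ j, ∑ k, TD x y i j k * ν k * g j)
    - (∑ j, ∑ k, TD x (reflPt y) i j k * reflVec ν k * reflVec g j)
    - (x 2 * pd i (phiD y g ν) x - if i = 2 then phiD y g ν x else 0)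

theorem hasFDerivAt_inv_norm_sub_pow {x y : E3} (hxy : x ≠ y) (n : ℕ) :
    HasFDerivAt (fun z : E3 => (‖x - z‖ ^ n)⁻¹)
      ((n / ‖x - y‖ ^ (n + 2)) • innerSL ℝ (x - y)) y := by
  have hR : ‖x - y‖ ≠ 0 := norm_ne_zero_iff.2 (sub_ne_zero.2 hxy)
  have hsq : HasFDerivAt (fun z : E3 => ‖x - z‖ ^ 2) (-(2 • innerSL ℝ (x - y))) y := by
    have h := ((hasFDerivAt_id y).const_sub x).norm_sq
    refine h.congr_fderiv ?_
    ext v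
    simp
    ring
  have hnorm : HasFDerivAt (fun z : E3 => ‖x - z‖) (-(‖x - y‖⁻¹ • innerSL ℝ (x - y))) y := by
    have h := hsq.sqrt (pow_ne_zero 2 hR)
    simp only [Real.sqrt_sq (norm_nonneg _)] at h
    refine h.congr_fderiv ?_
    ext v
    simp
    field_simp
  have h := ((hasDerivAt_pow n ‖x - y‖).inv (pow_ne_zero n hR)).comp_hasFDerivAt y hnorm
  refine h.congr_fderiv ?_
  ext v
  rcases n with _ | n
  · simp
  · simp
    field_simp
    ring

theorem pd_GS {x y : E3} (hxy : x ≠ y) (i : Fin 3) :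
    pd i (fun z => GS x z) y = (x i - y i) / (4 * π * ‖x - y‖ ^ 3) := by
  have h := (hasFDerivAt_inv_norm_sub_pow hxy 1).const_mul (4 * π)⁻¹
  have hGS : (fun z => GS x z) = fun z => (4 * π)⁻¹ * (‖x - z‖ ^ 1)⁻¹ := by
    funext z
    simp [GS, mul_comm]
  rw [pd, hGS, h.fderiv]
  simp [EuclideanSpace.inner_single_right]
  field_simp

theorem pd_pd_GS {x y : E3} (hxy : x ≠ y) (i j : Fin 3) :
    pd i (fun z => pd j (fun w => GS x w) z) y =
      (3 * (x i - y i) * (x j - y j) / ‖x - y‖ ^ 5 - kron i j / ‖x - y‖ ^ 3) / (4 * π) := by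
  have hR : ‖x - y‖ ≠ 0 := norm_ne_zero_iff.2 (sub_ne_zero.2 hxy)
  have hev : (fun z => pd j (fun w => GS x w) z) =ᶠ[nhds y]
      fun z => (4 * π)⁻¹ * ((x j - z j) * (‖x - z‖ ^ 3)⁻¹) := by
    filter_upwards [isOpen_ne.mem_nhds hxy.symm] with z hz
    rw [pd_GS (Ne.symm hz)]
    field_simp
  have hc : HasFDerivAt (fun z : E3 => x j - z j) (-(EuclideanSpace.proj j : E3 →L[ℝ] ℝ)) y :=
    (EuclideanSpace.proj j : E3 →L[ℝ] ℝ).hasFDerivAt.const_sub (x j)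
  have h := (hc.fun_mul (hasFDerivAt_inv_norm_sub_pow hxy 3)).const_mul (4 * π)⁻¹
  rw [pd, hev.fderiv_eq, h.fderiv]
  by_cases hij : i = j
  · subst hij
    simp [EuclideanSpace.inner_single_right, kron]
    field_simp
    ring
  · simp [EuclideanSpace.inner_single_right, kron, hij, Ne.symm hij]
    field_simp

theorem norm_sub_reflPt {x : E3} (hx : x 2 = 0) (y : E3) : ‖x - reflPt y‖ = ‖x - y‖ := by
  simp [EuclideanSpace.norm_eq, Fin.sum_univ_three, reflPt, hx]

/-- the half-space Stokes doublet `u^{D,W}` satisfies the no-slip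
condition on the plane `x₃ = 0`. -/
theorem stokes_doublet_halfspace_no_slip (y : E3) (hy : 0 < y 2) (g ν : Fin 3 → ℝ) :
    ∀ x : E3, x 2 = 0 → x ≠ reflPt y → ∀ i, uDW y g ν i x = 0 := by
  intro x hx hxy i
  have hR : ‖x - y‖ ≠ 0 := by
    rw [← norm_sub_reflPt hx]
    exact norm_ne_zero_iff.2 (sub_ne_zero.2 hxy)
  have h0 : reflPt y 0 = y 0 := by simp [reflPt]
  have h1 : reflPt y 1 = y 1 := by simp [reflPt]
  have h2 : reflPt y 2 = -y 2 := by simp [reflPt]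
  simp only [uDW, phiD, GD, GQ, pd_GS hxy, pd_pd_GS hxy, TD, norm_sub_reflPt hx, hx]
  fin_cases i <;>
    simp [Fin.sum_univ_three, kron, reflVec, h0, h1, h2, hx] <;>
    field_simp <;> ring
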